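/- arXiv:1410.1889 — 2 statements merged into one kernel-verified Lean document; each statement's English description precedes it below -/
import Mathlib

section
/- Let h ≥ 1. The canonical matrices 𝔤^a_b span a copy of gl(h) inside Lie(G) and act on the other canonical matrices as follows, where [A,B] = AB − BA and δ is the Kronecker delta: for all 1 ≤ a,b,c,d ≤ h, [𝔤^a_b, 𝔤^c_d] = δ^a_d 𝔤^c_b − δ^c_b 𝔤^a_d, [𝔤^a_b, 𝔱_{cd}] = δ^a_c 𝔱_{bd} + δ^a_d 𝔱_{bc}, [𝔤^a_b, 𝔱_c] = δ^a_c 𝔱_b, [𝔤^a_b, 𝔱] = 0, and [𝔤^a_b, 𝔨^c] = −δ^c_b 𝔨^a. These identities realize (up to an overall sign convention) the 𝔤^a_b-row of the paper's Lie bracket table. -/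
open Matrix

/-- Index type for the partition 2h+2 = 1+h+h+1. -/
abbrev Idx (h : ℕ) := Fin 1 ⊕ Fin h ⊕ Fin h ⊕ Fin 1

/-- Block index of a row/column index. -/
def blk {h : ℕ} : Idx h → Fin 4
  | .inl _ => 0
  | .inr (.inl _) => 1
  | .inr (.inr (.inl _)) => 2
  | .inr (.inr (.inr _)) => 3

/-- The constant intersection matrix Φ. -/
def Phi (R : Type*) [Ring R] (h : ℕ) : Matrix (Idx h) (Idx h) R :=
  fun i j => match i, j with
  | .inl _, .inr (.inr (.inr _)) => -1
  | .inr (.inl a), .inr (.inr (.inl b)) => if a = b then 1 else 0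
  | .inr (.inr (.inl a)), .inr (.inl b) => if a = b then -1 else 0
  | .inr (.inr (.inr _)), .inl _ => 1
  | _, _ => 0

/-- Block upper triangular: every block strictly below the block diagonal is zero. -/
def IsBUT {R : Type*} [Zero R] {h : ℕ} (M : Matrix (Idx h) (Idx h) R) : Prop :=
  ∀ i j, blk j < blk i → M i j = 0

/-- Canonical matrix 𝔱_{ab}: block (3,2) equal to (1/2)(e_a e_bᵀ + e_b e_aᵀ). -/
noncomputable def tMat2 (k : Type*) [Field k] {h : ℕ} (a b : Fin h) : Matrix (Idx h) (Idx h) k :=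
  fun i j => match i, j with
  | .inr (.inr (.inl i)), .inr (.inl j) =>
      (2 : k)⁻¹ * ((if i = a ∧ j = b then 1 else 0) + (if i = b ∧ j = a then 1 else 0))
  | _, _ => 0

/-- Canonical matrix 𝔱_a: block (3,1) equal to −e_a and block (4,2) equal to e_aᵀ. -/
noncomputable def tMat1 (k : Type*) [Field k] {h : ℕ} (a : Fin h) : Matrix (Idx h) (Idx h) k :=
  fun i j => match i, j with
  | .inr (.inr (.inl i)), .inl _ => if i = a then -1 else 0
  | .inr (.inr (.inr _)), .inr (.inl j) => if j = a then 1 else 0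
  | _, _ => 0

/-- Canonical matrix 𝔱: block (4,1) equal to −1. -/
noncomputable def tMat0 (k : Type*) [Field k] (h : ℕ) : Matrix (Idx h) (Idx h) k :=
  fun i j => match i, j with
  | .inr (.inr (.inr _)), .inl _ => -1
  | _, _ => 0

/-- Canonical matrix 𝔨^a: block (2,1) equal to e_a and block (4,3) equal to e_aᵀ. -/
noncomputable def kMat (k : Type*) [Field k] {h : ℕ} (a : Fin h) : Matrix (Idx h) (Idx h) k :=
  fun i j => match i, j with
  | .inr (.inl i), .inl _ => if i = a then 1 else 0
  | .inr (.inr (.inr _)), .inr (.inr (.inl j)) => if j = a then 1 else 0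
  | _, _ => 0

/-- Canonical matrix 𝔤^a_b: block (2,2) equal to −e_a e_bᵀ and block (3,3) equal to e_b e_aᵀ. -/
noncomputable def gMat (k : Type*) [Field k] {h : ℕ} (a b : Fin h) : Matrix (Idx h) (Idx h) k :=
  fun i j => match i, j with
  | .inr (.inl i), .inr (.inl j) => if i = a ∧ j = b then -1 else 0
  | .inr (.inr (.inl i)), .inr (.inr (.inl j)) => if i = b ∧ j = a then 1 else 0
  | _, _ => 0

/-- Canonical matrix 𝔤₀: block (1,1) equal to −1 and block (4,4) equal to 1. -/
noncomputable def g0Mat (k : Type*) [Field k] (h : ℕ) : Matrix (Idx h) (Idx h) k :=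
  fun i j => match i, j with
  | .inl _, .inl _ => -1
  | .inr (.inr (.inr _)), .inr (.inr (.inr _)) => 1
  | _, _ => 0

theorem gMat_commutator_gMat (k : Type*) [Field k] {h : ℕ} (a b c d : Fin h) :
    gMat k a b * gMat k c d - gMat k c d * gMat k a b =
      (if a = d then (1 : k) else 0) • gMat k c b -
      (if c = b then (1 : k) else 0) • gMat k a d := by
  ext (i | i | i | i) (j | j | j | j) <;>
    simp [-ite_smul, mul_apply, gMat, ite_and] <;>
    grind

theorem gMat_commutator_tMat2 (k : Type*) [Field k] {h : ℕ} (a b c d : Fin h) :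
    gMat k a b * tMat2 k c d - tMat2 k c d * gMat k a b =
      (if a = c then (1 : k) else 0) • tMat2 k b d +
      (if a = d then (1 : k) else 0) • tMat2 k b c := by
  ext (i | i | i | i) (j | j | j | j) <;>
    simp [-ite_smul, mul_apply, gMat, tMat2, ite_and, mul_add, Finset.sum_add_distrib] <;>
    grind

theorem gMat_commutator_tMat1 (k : Type*) [Field k] {h : ℕ} (a b c : Fin h) :
    gMat k a b * tMat1 k c - tMat1 k c * gMat k a b =
      (if a = c then (1 : k) else 0) • tMat1 k b := by
  ext (i | i | i | i) (j | j | j | j) <;>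
    simp [-ite_smul, mul_apply, gMat, tMat1, ite_and] <;>
    grind

theorem gMat_commutator_tMat0 (k : Type*) [Field k] {h : ℕ} (a b : Fin h) :
    gMat k a b * tMat0 k h - tMat0 k h * gMat k a b = 0 := by
  ext (i | i | i | i) (j | j | j | j) <;>
    simp [mul_apply, gMat, tMat0]

theorem gMat_commutator_kMat (k : Type*) [Field k] {h : ℕ} (a b c : Fin h) :
    gMat k a b * kMat k c - kMat k c * gMat k a b =
      -((if c = b then (1 : k) else 0) • kMat k a) := by
  ext (i | i | i | i) (j | j | j | j) <;>
    simp [-ite_smul, mul_apply, gMat, kMat, ite_and] <;>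
    grind

/-- The matrices 𝔤^a_b span a copy of gl(h) inside Lie(G) and act on the other
canonical matrices by: [𝔤^a_b,𝔤^c_d] = δ^a_d 𝔤^c_b − δ^c_b 𝔤^a_d,
[𝔤^a_b,𝔱_{cd}] = δ^a_c 𝔱_{bd} + δ^a_d 𝔱_{bc}, [𝔤^a_b,𝔱_c] = δ^a_c 𝔱_b,
[𝔤^a_b,𝔱] = 0, [𝔤^a_b,𝔨^c] = −δ^c_b 𝔨^a. -/
theorem statement7 (k : Type*) [Field k] [CharZero k] (h : ℕ) (hh : 1 ≤ h) :
    (∀ a b c d : Fin h,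
      gMat k a b * gMat k c d - gMat k c d * gMat k a b =
        (if a = d then (1 : k) else 0) • gMat k c b -
        (if c = b then (1 : k) else 0) • gMat k a d) ∧
    (∀ a b c d : Fin h,
      gMat k a b * tMat2 k c d - tMat2 k c d * gMat k a b =
        (if a = c then (1 : k) else 0) • tMat2 k b d +
        (if a = d then (1 : k) else 0) • tMat2 k b c) ∧
    (∀ a b c : Fin h,
      gMat k a b * tMat1 k c - tMat1 k c * gMat k a b =
        (if a = c then (1 : k) else 0) • tMat1 k b) ∧
    (∀ a b : Fin h,
      gMat k a b * tMat0 k h - tMat0 k h * gMat k a b = 0) ∧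
    (∀ a b c : Fin h,
      gMat k a b * kMat k c - kMat k c * gMat k a b =
        -((if c = b then (1 : k) else 0) • kMat k a)) := by
  exact ⟨gMat_commutator_gMat k, gMat_commutator_tMat2 k, gMat_commutator_tMat1 k,
    gMat_commutator_tMat0 k, gMat_commutator_kMat k⟩
end

section
/- Let h ≥ 1, let U ⊆ ℝ^h be an open set, and let F₀ : U → ℝ be three times continuously differentiable. Write F_a = ∂F₀/∂t^a, F_{ab} = ∂²F₀/∂t^a∂t^b and C_{abc} = ∂³F₀/∂t^a∂t^b∂t^c. For t ∈ U define the (2h+2)×(2h+2) matrix P(t) in block form by: row block 1 = (1, t^c, F_c(t), 2F₀(t) − Σ_d t^d F_d(t)); row block 2 (indexed by a) = (0, δ^c_a, F_{ac}(t), F_a(t) − Σ_d t^d F_{ad}(t)); row block 3 (indexed by a) = (0, 0, δ^a_c, −t^a); row block 4 = (0,0,0,−1). For each 1 ≤ b ≤ h define the matrix N_b(t) in block form as: block (1,2) equal to the row vector (δ^c_b), block (2,3) equal to the h×h matrix (C_{abc}(t))_{a,c}, block (3,4) equal to the column vector (δ^a_b), and all other blocks zero. Then for every t ∈ U and every b,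 ∂P/∂t^b (t) = N_b(t) · P(t). (This is the statement that the flat basis ω_t satisfies the first-order system with connection matrices of Yukawa shape.) -/
open Matrix

/-- Partial derivative in the direction of the a-th coordinate. -/
noncomputable def pd {h : ℕ} (a : Fin h) (f : (Fin h → ℝ) → ℝ) : (Fin h → ℝ) → ℝ :=
  fun x => fderiv ℝ f x (Pi.single a 1)

/-- The period-type matrix P built from coordinates t, first derivatives f,
prepotential value f₀ and second derivatives τ. -/
noncomputable def Pmat (R : Type*) [CommRing R] {h : ℕ}
    (t f : Fin h → R) (f0 : R) (τ : Matrix (Fin h) (Fin h) R) :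
    Matrix (Idx h) (Idx h) R :=
  fun i j => match i, j with
  | .inl _, .inl _ => 1
  | .inl _, .inr (.inl c) => t c
  | .inl _, .inr (.inr (.inl c)) => f c
  | .inl _, .inr (.inr (.inr _)) => 2 * f0 - ∑ d, t d * f d
  | .inr (.inl a), .inr (.inl c) => if a = c then 1 else 0
  | .inr (.inl a), .inr (.inr (.inl c)) => τ a c
  | .inr (.inl a), .inr (.inr (.inr _)) => f a - ∑ d, t d * τ a d
  | .inr (.inr (.inl a)), .inr (.inr (.inl c)) => if a = c then 1 else 0
  | .inr (.inr (.inl a)), .inr (.inr (.inr _)) => - t a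
  | .inr (.inr (.inr _)), .inr (.inr (.inr _)) => -1
  | _, _ => 0

/-- The connection matrix of Yukawa shape: block (1,2) is the row vector e_bᵀ,
block (2,3) is C, block (3,4) is the column vector e_b, all other blocks 0. -/
noncomputable def Nmat (R : Type*) [Ring R] {h : ℕ} (b : Fin h)
    (C : Matrix (Fin h) (Fin h) R) : Matrix (Idx h) (Idx h) R :=
  fun i j => match i, j with
  | .inl _, .inr (.inl q) => if q = b then 1 else 0
  | .inr (.inl p), .inr (.inr (.inl q)) => C p q
  | .inr (.inr (.inl p)), .inr (.inr (.inr _)) => if p = b then 1 else 0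
  | _, _ => 0

/-- The period matrix of the flat basis ω_t associated with a prepotential F₀. -/
noncomputable def perMat {h : ℕ} (F0 : (Fin h → ℝ) → ℝ) (t : Fin h → ℝ) :
    Matrix (Idx h) (Idx h) ℝ :=
  Pmat ℝ t (fun a => pd a F0 t) (F0 t) (Matrix.of fun a c => pd a (pd c F0) t)

/-- A partial derivative of a `C^(n+1)` function on an open set is `C^n`. -/
theorem ContDiffOn.pd {h : ℕ} {U : Set (Fin h → ℝ)} (hU : IsOpen U) {m n : WithTop ℕ∞}
    {f : (Fin h → ℝ) → ℝ} (hf : ContDiffOn ℝ n f U) (hmn : m + 1 ≤ n) (a : Fin h) :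
    ContDiffOn ℝ m (pd a f) U :=
  (hf.fderiv_of_isOpen hU hmn).clm_apply contDiffOn_const

/-- Partial derivatives of a `C^2` function commute. -/
theorem pd_comm {h : ℕ} {f : (Fin h → ℝ) → ℝ} {t : Fin h → ℝ} (hf : ContDiffAt ℝ 2 f t)
    (a b : Fin h) : pd a (pd b f) t = pd b (pd a f) t := by
  have hd : DifferentiableAt ℝ (fderiv ℝ f) t :=
    (hf.fderiv_right (m := 1) (by norm_num)).differentiableAt (by norm_num)
  have key (c d : Fin h) : pd c (pd d f) t =
      fderiv ℝ (fderiv ℝ f) t (Pi.single c 1) (Pi.single d 1) := by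
    change fderiv ℝ (fun s => fderiv ℝ f s (Pi.single d 1)) t (Pi.single c 1) = _
    rw [fderiv_clm_apply hd (differentiableAt_const _)]
    simp
  rw [key, key]
  exact hf.isSymmSndFDerivAt (by simp) _ _

theorem pd_const {h : ℕ} (b : Fin h) (r : ℝ) (t : Fin h → ℝ) : pd b (fun _ => r) t = 0 := by
  simp [pd]

theorem pd_coord {h : ℕ} (b c : Fin h) (t : Fin h → ℝ) :
    pd b (fun s => s c) t = if c = b then 1 else 0 := by
  simp [pd, fderiv_apply, Pi.single_apply]

theorem pd_sub {h : ℕ} (b : Fin h) {f g : (Fin h → ℝ) → ℝ} {t : Fin h → ℝ}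
    (hf : DifferentiableAt ℝ f t) (hg : DifferentiableAt ℝ g t) :
    pd b (fun s => f s - g s) t = pd b f t - pd b g t := by
  simp [pd, fderiv_fun_sub hf hg]

/-- Leibniz rule for the Euler-type sum `∑ d, t d * g d`. -/
theorem pd_sum_coord_mul {h : ℕ} (b : Fin h) {g : Fin h → (Fin h → ℝ) → ℝ} {t : Fin h → ℝ}
    (hg : ∀ d, DifferentiableAt ℝ (g d) t) :
    pd b (fun s => ∑ d, s d * g d s) t = g b t + ∑ d, t d * pd b (g d) t := by
  have hc (d : Fin h) : DifferentiableAt ℝ (fun s : Fin h → ℝ => s d) t := by fun_prop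
  simp only [pd]
  rw [fderiv_fun_sum fun d _ => (hc d).fun_mul (hg d)]
  simp [fderiv_fun_mul (hc _) (hg _), fderiv_apply, Pi.single_apply, Finset.sum_add_distrib,
    add_comm]

/-- For a C³ prepotential F₀ on an open set U, the period matrix P(t) of the
flat basis satisfies ∂P/∂t^b = N_b(t) · P(t), where N_b has the Yukawa shape with
C_{abc} = ∂_a∂_b∂_c F₀. -/
theorem statement10 (h : ℕ) (hh : 1 ≤ h) (U : Set (Fin h → ℝ)) (hU : IsOpen U)
    (F0 : (Fin h → ℝ) → ℝ) (hF : ContDiffOn ℝ 3 F0 U) :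
    ∀ t ∈ U, ∀ b : Fin h, ∀ i j : Idx h,
      pd b (fun s => perMat F0 s i j) t =
        (Nmat ℝ b (Matrix.of fun a c => pd a (pd b (pd c F0)) t) * perMat F0 t) i j := by
  intro t ht b i j
  have hUt : U ∈ nhds t := hU.mem_nhds ht
  have hF1 (a : Fin h) : ContDiffOn ℝ 2 (pd a F0) U := hF.pd hU (by norm_num) a
  have hF2 (a c : Fin h) : ContDiffOn ℝ 1 (pd a (pd c F0)) U :=
    (hF1 c).pd hU (by norm_num) a
  have d0 : DifferentiableAt ℝ F0 t := (hF.contDiffAt hUt).differentiableAt (by norm_num)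
  have d1 (a : Fin h) : DifferentiableAt ℝ (pd a F0) t :=
    ((hF1 a).contDiffAt hUt).differentiableAt (by norm_num)
  have d2 (a c : Fin h) : DifferentiableAt ℝ (pd a (pd c F0)) t :=
    ((hF2 a c).contDiffAt hUt).differentiableAt (by norm_num)
  have s2 (a c : Fin h) : pd a (pd c F0) t = pd c (pd a F0) t :=
    pd_comm ((hF.contDiffAt hUt).of_le (by norm_num)) a c
  have s3 (a c : Fin h) : pd b (pd a (pd c F0)) t = pd a (pd b (pd c F0)) t :=
    pd_comm ((hF1 c).contDiffAt hUt) b a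
  have e0 : pd b (fun s => 2 * F0 s - ∑ d, s d * pd d F0 s) t =
      pd b F0 t - ∑ d, t d * pd b (pd d F0) t := by
    rw [pd_sub b (d0.const_mul 2) (by fun_prop), pd_sum_coord_mul b d1]
    simp only [pd, fderiv_const_mul d0, _root_.smul_apply, smul_eq_mul]
    ring
  have e1 (a : Fin h) : pd b (fun s => pd a F0 s - ∑ d, s d * pd a (pd d F0) s) t =
      - ∑ d, pd a (pd b (pd d F0)) t * t d := by
    rw [pd_sub b (d1 a) (by fun_prop), pd_sum_coord_mul b (d2 a), s2 b a]
    simp [s3, mul_comm]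
  have e2 (a : Fin h) : pd b (fun s => -s a) t = -(if a = b then 1 else 0) := by
    rw [← pd_coord b a t]
    simp [pd, fderiv_fun_neg]
  rcases i with i | i | i | i <;> rcases j with j | j | j | j <;>
    simp [Matrix.mul_apply, Fintype.sum_sum_type, perMat, Pmat, Nmat, pd_const, pd_coord,
      e0, e1, e2, s3, eq_comm]
end
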